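/- Let F be a binary cubic form with integer coefficients and non-zero discriminant, let 𝔽 be the splitting field of F over ℚ, let μ₃ be a primitive third root of unity, and let X_F ⊂ ℙ³ be the surface F(x₁,x₂) − F(x₃,x₄) = 0. Then the smallest field K over which all 27 lines contained in X_F are defined is K = 𝔽(μ₃). -/

import Mathlib

/-- A fixed algebraic closure of `ℚ`. -/
abbrev Qbar : Type := AlgebraicClosure ℚ

/-- The lines (one-dimensional linear subvarieties of `ℙ³`, identified with two-dimensional
linear subspaces of `Qbar⁴`) contained in the surface
`X_F : F(x₁,x₂) − F(x₃,x₄) = 0`, for a binary form `F : Qbar → Qbar → Qbar`. -/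
noncomputable def surfaceLines (F : Qbar → Qbar → Qbar) : Set (Submodule Qbar (Fin 4 → Qbar)) :=
  {W | Module.finrank Qbar W = 2 ∧ ∀ v ∈ W, F (v 0) (v 1) = F (v 2) (v 3)}

/-- A line (a two-dimensional subspace `W` of `Qbar⁴`) is defined over a subfield `K` of
`Qbar` if `W` is spanned by two vectors all of whose coordinates lie in `K`. -/
def LineDefinedOver (K : IntermediateField ℚ Qbar)
    (W : Submodule Qbar (Fin 4 → Qbar)) : Prop :=
  ∃ v w : Fin 4 → Qbar, (∀ i, v i ∈ K) ∧ (∀ i, w i ∈ K) ∧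
    W = Submodule.span Qbar {v, w}

/-- The binary cubic form `b₃x³ + b₂x²y + b₁xy² + b₀y³` with integer coefficients,
over `Qbar`. -/
noncomputable def cubicFormA (b₃ b₂ b₁ b₀ : ℤ) (x y : Qbar) : Qbar :=
  (b₃ : Qbar) * x ^ 3 + (b₂ : Qbar) * x ^ 2 * y + (b₁ : Qbar) * x * y ^ 2 + (b₀ : Qbar) * y ^ 3

/-- The discriminant of a binary cubic form. -/
def cubicDisc (b₃ b₂ b₁ b₀ : ℤ) : ℤ :=
  18 * b₃ * b₂ * b₁ * b₀ - 4 * b₂ ^ 3 * b₀ + b₂ ^ 2 * b₁ ^ 2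
    - 4 * b₃ * b₁ ^ 3 - 27 * b₃ ^ 2 * b₀ ^ 2

/-- The splitting field `𝔽` of the cubic form `F` inside `Qbar`: the field generated over
`ℚ` by the roots of `F(x,1)`. -/
noncomputable def splittingFieldOfCubic (b₃ b₂ b₁ b₀ : ℤ) : IntermediateField ℚ Qbar :=
  IntermediateField.adjoin ℚ {z : Qbar | cubicFormA b₃ b₂ b₁ b₀ z 1 = 0}

section FieldOfDefinition

open Submodule

/-- A two-dimensional subspace of a coordinate space has a basis in reduced form with respect to
some pair of coordinates. -/
lemma exists_reduced_basis {k ι : Type*} [Field k] (W : Submodule k (ι → k))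
    (hW : Module.finrank k W = 2) :
    ∃ (i j : ι) (v w : ι → k), i ≠ j ∧ v i = 1 ∧ v j = 0 ∧ w i = 0 ∧ w j = 1 ∧
      W = span k {v, w} := by
  have : Module.Finite k W := Module.finite_of_finrank_pos (by omega)
  let b := Module.finBasisOfFinrankEq k W hW
  obtain ⟨v, hv⟩ : ∃ v : ι → k, v = b 0 := ⟨_, rfl⟩
  obtain ⟨w, hw⟩ : ∃ w : ι → k, w = b 1 := ⟨_, rfl⟩
  have hvW : v ∈ W := hv ▸ (b 0).2
  have hwW : w ∈ W := hw ▸ (b 1).2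
  have hspan : ∀ z ∈ W, ∃ s t : k, z = s • v + t • w := by
    intro z hz
    refine ⟨b.repr ⟨z, hz⟩ 0, b.repr ⟨z, hz⟩ 1, ?_⟩
    have h := congrArg Subtype.val (b.sum_repr ⟨z, hz⟩)
    rw [Fin.sum_univ_two] at h
    rw [hv, hw]
    exact h.symm
  have hind : ∀ s t : k, s • v + t • w = 0 → s = 0 ∧ t = 0 := by
    have hli := b.linearIndependent.map' W.subtype W.ker_subtype
    intro s t h
    have h' := Fintype.linearIndependent_iff.1 hli ![s, t]
      (by simpa [Fin.sum_univ_two, ← hv, ← hw] using h)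
    exact ⟨h' 0, h' 1⟩
  obtain ⟨i, j, hij⟩ : ∃ i j, v i * w j - v j * w i ≠ 0 := by
    by_contra! hminor
    have hv0 : v ≠ 0 := fun h => one_ne_zero (hind 1 0 (by simp [h])).1
    obtain ⟨i, hi⟩ := Function.ne_iff.1 hv0
    refine hi (hind (-w i) (v i) ?_).2
    funext j
    simp only [Pi.add_apply, Pi.smul_apply, smul_eq_mul, Pi.zero_apply]
    linear_combination hminor i j
  refine ⟨i, j, (v i * w j - v j * w i)⁻¹ • (w j • v - v j • w),
    (v i * w j - v j * w i)⁻¹ • (v i • w - w i • v), ?_, ?_, ?_, ?_, ?_, ?_⟩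
  · rintro rfl
    exact hij (by ring)
  · simp only [Pi.smul_apply, Pi.sub_apply, smul_eq_mul]
    field_simp
  · simp only [Pi.smul_apply, Pi.sub_apply, smul_eq_mul]
    ring
  · simp only [Pi.smul_apply, Pi.sub_apply, smul_eq_mul]
    ring
  · simp only [Pi.smul_apply, Pi.sub_apply, smul_eq_mul]
    field_simp
  · apply le_antisymm
    · intro z hz
      obtain ⟨s, t, rfl⟩ := hspan z hz
      refine mem_span_pair.2 ⟨s * v i + t * w i, s * v j + t * w j, ?_⟩
      funext m
      simp only [Pi.smul_apply, Pi.sub_apply, Pi.add_apply, smul_eq_mul]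
      linear_combination (s * v m + t * w m) * inv_mul_cancel₀ hij
    · rw [span_le, Set.insert_subset_iff, Set.singleton_subset_iff]
      exact ⟨W.smul_mem _ (W.sub_mem (W.smul_mem _ hvW) (W.smul_mem _ hwW)),
        W.smul_mem _ (W.sub_mem (W.smul_mem _ hwW) (W.smul_mem _ hvW))⟩

/-- The coefficients of a line `c = α a + β b`, `d = γ a + δ b` on the Fermat cubic
`a³ + b³ + c³ + d³ = 0` are zero or negatives of cube roots of unity. -/
lemma fermat_coefficients {k : Type*} [Field k] {α β γ δ : k}
    (h₁ : 1 + α ^ 3 + γ ^ 3 = 0) (h₂ : 1 + β ^ 3 + δ ^ 3 = 0)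
    (h₃ : α ^ 2 * β + γ ^ 2 * δ = 0) (h₄ : α * β ^ 2 + γ * δ ^ 2 = 0) :
    (α = 0 ∧ δ = 0 ∧ β ^ 3 = -1 ∧ γ ^ 3 = -1) ∨ (β = 0 ∧ γ = 0 ∧ α ^ 3 = -1 ∧ δ ^ 3 = -1) := by
  by_cases hα : α = 0
  · subst hα
    have hγ : γ ^ 3 = -1 := by linear_combination h₁
    have hγ0 : γ ≠ 0 := by rintro rfl; simp at hγ
    have hδ : δ = 0 := by simpa [hγ0] using h₃
    subst hδ
    exact .inl ⟨rfl, rfl, by linear_combination h₂, hγ⟩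
  by_cases hβ : β = 0
  · subst hβ
    have hδ : δ ^ 3 = -1 := by linear_combination h₂
    have hδ0 : δ ≠ 0 := by rintro rfl; simp at hδ
    have hγ : γ = 0 := by simpa [hδ0] using h₃
    subst hγ
    exact .inr ⟨rfl, rfl, by linear_combination h₁, hδ⟩
  exfalso
  have hγ : γ ≠ 0 := by
    rintro rfl
    simp [hα, hβ] at h₃
  have hδ : δ ≠ 0 := by
    rintro rfl
    simp [hα, hβ] at h₃
  have hdet : α * δ - β * γ = 0 := by
    have : γ * δ * (α * δ - β * γ) = 0 := by
      linear_combination α * h₄ - β * h₃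
    simpa [hγ, hδ] using this
  have hsum : α ^ 3 + γ ^ 3 = 0 := by
    have : β * (α ^ 3 + γ ^ 3) = 0 := by
      linear_combination α * h₃ - γ ^ 2 * hdet
    simpa [hβ] using this
  exact one_ne_zero (by linear_combination h₁ - hsum : (1 : k) = 0)

lemma mem_of_cube_eq_neg_one {k : Type*} [Field k] [Algebra ℚ k] {K : IntermediateField ℚ k}
    {μ α : k} (hμ : IsPrimitiveRoot μ 3) (hμK : μ ∈ K) (hα : α ^ 3 = -1) : α ∈ K := by
  obtain ⟨n, -, hn⟩ := hμ.eq_pow_of_pow_eq_one (ξ := -α) (by linear_combination -hα)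
  rw [← neg_neg α, ← hn]
  exact K.neg_mem (pow_mem hμK n)

/-- The lines on the Fermat cubic surface are defined over any field containing the cube roots
of unity. -/
lemma lineDefinedOver_of_fermat {K : IntermediateField ℚ Qbar} {μ : Qbar}
    (hμ : IsPrimitiveRoot μ 3) (hμK : μ ∈ K) {W : Submodule Qbar (Fin 4 → Qbar)}
    (hW : Module.finrank Qbar W = 2) (hF : ∀ z ∈ W, ∑ i, z i ^ 3 = 0) :
    LineDefinedOver K W := by
  obtain ⟨i, j, v, w, hij, hvi, hvj, hwi, hwj, rfl⟩ := exists_reduced_basis W hW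
  obtain ⟨σ, rfl, rfl⟩ : ∃ σ : Equiv.Perm (Fin 4), σ 0 = i ∧ σ 1 = j := by
    clear hvi hvj hwi hwj
    revert i j
    decide
  have hst : ∀ s t : Qbar, s ^ 3 + t ^ 3 + (s * v (σ 2) + t * w (σ 2)) ^ 3 +
      (s * v (σ 3) + t * w (σ 3)) ^ 3 = 0 := by
    intro s t
    have h := hF _ (mem_span_pair.2 ⟨s, t, rfl⟩)
    rw [← Equiv.sum_comp σ] at h
    simpa [Fin.sum_univ_four, hvi, hvj, hwi, hwj] using h
  have h₁ := hst 1 0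
  have h₂ := hst 0 1
  have h₃ := hst 1 1
  have h₄ := hst 1 (-1)
  have hcoef := fermat_coefficients (α := v (σ 2)) (β := w (σ 2)) (γ := v (σ 3)) (δ := w (σ 3))
    (by linear_combination h₁) (by linear_combination h₂)
    (by linear_combination (1 / 6 : Qbar) * (h₃ - h₄) - (1 / 3 : Qbar) * h₂)
    (by linear_combination (1 / 6 : Qbar) * (h₃ + h₄) - (1 / 3 : Qbar) * h₁)
  have hmem : (v (σ 2) ∈ K ∧ v (σ 3) ∈ K) ∧ (w (σ 2) ∈ K ∧ w (σ 3) ∈ K) := by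
    rcases hcoef with ⟨h1, h2, h3, h4⟩ | ⟨h1, h2, h3, h4⟩
    · exact ⟨⟨h1 ▸ K.zero_mem, mem_of_cube_eq_neg_one hμ hμK h4⟩,
        ⟨mem_of_cube_eq_neg_one hμ hμK h3, h2 ▸ K.zero_mem⟩⟩
    · exact ⟨⟨mem_of_cube_eq_neg_one hμ hμK h3, h2 ▸ K.zero_mem⟩,
        ⟨h1 ▸ K.zero_mem, mem_of_cube_eq_neg_one hμ hμK h4⟩⟩
  refine ⟨v, w, fun m => ?_, fun m => ?_, rfl⟩ <;> obtain ⟨m, rfl⟩ := σ.surjective m <;>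
    fin_cases m
  · exact hvi ▸ K.one_mem
  · exact hvj ▸ K.zero_mem
  · exact hmem.1.1
  · exact hmem.1.2
  · exact hwi ▸ K.zero_mem
  · exact hwj ▸ K.one_mem
  · exact hmem.2.1
  · exact hmem.2.2

/-- The linear change of coordinates on `k⁴` acting on the first pair of coordinates through the
matrix `(p₁ p₂; q₁ q₂)` and on the second pair through its negative. -/
def pairEquiv {k : Type*} [Field k] (p₁ p₂ q₁ q₂ : k) (hd : p₁ * q₂ - p₂ * q₁ ≠ 0) :
    (Fin 4 → k) ≃ₗ[k] (Fin 4 → k) where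
  toFun x := ![p₁ * x 0 + p₂ * x 1, q₁ * x 0 + q₂ * x 1,
    -(p₁ * x 2 + p₂ * x 3), -(q₁ * x 2 + q₂ * x 3)]
  invFun y := ![(q₂ * y 0 - p₂ * y 1) / (p₁ * q₂ - p₂ * q₁),
    (p₁ * y 1 - q₁ * y 0) / (p₁ * q₂ - p₂ * q₁),
    (p₂ * y 3 - q₂ * y 2) / (p₁ * q₂ - p₂ * q₁),
    (q₁ * y 2 - p₁ * y 3) / (p₁ * q₂ - p₂ * q₁)]
  map_add' x y := by
    ext m
    fin_cases m <;> simp <;> ring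
  map_smul' c x := by
    ext m
    fin_cases m <;> simp <;> ring
  left_inv x := by
    ext m
    fin_cases m <;> simp
    · linear_combination x 0 * inv_mul_cancel₀ hd
    · linear_combination x 1 * inv_mul_cancel₀ hd
    · linear_combination x 2 * inv_mul_cancel₀ hd
    · linear_combination x 3 * inv_mul_cancel₀ hd
  right_inv y := by
    ext m
    fin_cases m <;> simp
    · linear_combination y 0 * inv_mul_cancel₀ hd
    · linear_combination y 1 * inv_mul_cancel₀ hd
    · linear_combination y 2 * inv_mul_cancel₀ hd
    · linear_combination y 3 * inv_mul_cancel₀ hd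

/-- If `F = e l m (l + m)` for independent linear forms `l`, `m` over a field `K` containing the
cube roots of unity, then all lines on `X_F` are defined over `K`. -/
lemma lineDefinedOver_of_factorization {K : IntermediateField ℚ Qbar} {μ : Qbar}
    (hμ : IsPrimitiveRoot μ 3) (hμK : μ ∈ K) {F : Qbar → Qbar → Qbar} {e l₁ l₂ m₁ m₂ : Qbar}
    (he : e ≠ 0) (hl₁ : l₁ ∈ K) (hl₂ : l₂ ∈ K) (hm₁ : m₁ ∈ K) (hm₂ : m₂ ∈ K)
    (hd : l₁ * m₂ - l₂ * m₁ ≠ 0)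
    (hF : ∀ x y, F x y = e * ((l₁ * x + l₂ * y) * (m₁ * x + m₂ * y) *
      ((l₁ * x + l₂ * y) + (m₁ * x + m₂ * y))))
    {W : Submodule Qbar (Fin 4 → Qbar)} (hW : W ∈ surfaceLines F) :
    LineDefinedOver K W := by
  have hμ0 : μ ≠ 0 := hμ.ne_zero (by norm_num)
  have hμ1 : μ - 1 ≠ 0 := sub_ne_zero.2 (hμ.ne_one (by norm_num))
  have hμ3 : μ ^ 3 = 1 := hμ.pow_eq_one
  let p₁ := l₁ - μ * m₁
  let p₂ := l₂ - μ * m₂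
  let q₁ := μ ^ 2 * m₁ - l₁
  let q₂ := μ ^ 2 * m₂ - l₂
  have hp₁ : p₁ ∈ K := K.sub_mem hl₁ (K.mul_mem hμK hm₁)
  have hp₂ : p₂ ∈ K := K.sub_mem hl₂ (K.mul_mem hμK hm₂)
  have hq₁ : q₁ ∈ K := K.sub_mem (K.mul_mem (pow_mem hμK 2) hm₁) hl₁
  have hq₂ : q₂ ∈ K := K.sub_mem (K.mul_mem (pow_mem hμK 2) hm₂) hl₂
  have hpq : p₁ * q₂ - p₂ * q₁ ≠ 0 := by
    have : p₁ * q₂ - p₂ * q₁ = μ * (μ - 1) * (l₁ * m₂ - l₂ * m₁) := by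
      simp only [p₁, p₂, q₁, q₂]
      ring
    rw [this]
    exact mul_ne_zero (mul_ne_zero hμ0 hμ1) hd
  let φ := pairEquiv p₁ p₂ q₁ q₂ hpq
  have hcube : ∀ l m : Qbar, (l - μ * m) ^ 3 + (μ ^ 2 * m - l) ^ 3 =
      3 * (μ * (μ - 1)) * (l * m * (l + m)) := by
    intro l m
    linear_combination (-3 * μ * l * m ^ 2 + m ^ 3 * (μ ^ 3 + 1) - m ^ 3) * hμ3
  obtain ⟨hrank, hsurf⟩ := hW
  obtain ⟨v, w, hv, hw, hvw⟩ := lineDefinedOver_of_fermat (W := W.map φ.toLinearMap) hμ hμK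
    (by rw [← hrank]; exact LinearEquiv.finrank_map_eq φ W) (by
      rintro _ ⟨x, hx, rfl⟩
      have h := hsurf x hx
      rw [hF, hF] at h
      have h' := mul_left_cancel₀ he h
      have e₁ := hcube (l₁ * x 0 + l₂ * x 1) (m₁ * x 0 + m₂ * x 1)
      have e₂ := hcube (l₁ * x 2 + l₂ * x 3) (m₁ * x 2 + m₂ * x 3)
      simp only [φ, pairEquiv, Fin.sum_univ_four, p₁, p₂, q₁, q₂]
      simp
      linear_combination e₁ - e₂ + 3 * (μ * (μ - 1)) * h')
  have hsymm : ∀ z : Fin 4 → Qbar, (∀ i, z i ∈ K) → ∀ i, φ.symm z i ∈ K := by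
    intro z hz i
    have hdK := K.sub_mem (K.mul_mem hp₁ hq₂) (K.mul_mem hp₂ hq₁)
    fin_cases i
    · exact K.div_mem (K.sub_mem (K.mul_mem hq₂ (hz 0)) (K.mul_mem hp₂ (hz 1))) hdK
    · exact K.div_mem (K.sub_mem (K.mul_mem hp₁ (hz 1)) (K.mul_mem hq₁ (hz 0))) hdK
    · exact K.div_mem (K.sub_mem (K.mul_mem hp₂ (hz 3)) (K.mul_mem hq₂ (hz 2))) hdK
    · exact K.div_mem (K.sub_mem (K.mul_mem hq₁ (hz 2)) (K.mul_mem hp₁ (hz 3))) hdK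
  refine ⟨φ.symm v, φ.symm w, hsymm v hv, hsymm w hw, ?_⟩
  have h := congrArg (Submodule.map φ.symm.toLinearMap) hvw
  rw [← Submodule.map_comp, Submodule.map_span, Set.image_pair] at h
  simpa using h

lemma exists_mul_sub_eq_quadratic {k : Type*} [Field k] [IsAlgClosed k] {a : k} (ha : a ≠ 0)
    (b c : k) : ∃ r s : k, b = -a * (r + s) ∧ c = a * (r * s) := by
  obtain ⟨r, hr⟩ := IsAlgClosed.exists_root
    (Polynomial.C a * Polynomial.X ^ 2 + Polynomial.C b * Polynomial.X + Polynomial.C c)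
    (by rw [Polynomial.degree_quadratic ha]; norm_num)
  refine ⟨r, -b / a - r, ?_, ?_⟩
  · field_simp
    ring
  · simp only [Polynomial.IsRoot.def, Polynomial.eval_add, Polynomial.eval_mul,
      Polynomial.eval_C, Polynomial.eval_pow, Polynomial.eval_X] at hr
    field_simp
    linear_combination hr

lemma exists_mul_sub_eq_cubic {k : Type*} [Field k] [IsAlgClosed k] {a : k} (ha : a ≠ 0)
    (b c d : k) : ∃ r s t : k, b = -a * (r + s + t) ∧ c = a * (r * s + r * t + s * t) ∧
      d = -a * (r * s * t) := by
  obtain ⟨r, hr⟩ := IsAlgClosed.exists_root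
    (Polynomial.C a * Polynomial.X ^ 3 + Polynomial.C b * Polynomial.X ^ 2 +
      Polynomial.C c * Polynomial.X + Polynomial.C d)
    (by rw [Polynomial.degree_cubic ha]; norm_num)
  simp only [Polynomial.IsRoot.def, Polynomial.eval_add, Polynomial.eval_mul,
    Polynomial.eval_C, Polynomial.eval_pow, Polynomial.eval_X] at hr
  obtain ⟨s, t, h₁, h₂⟩ := exists_mul_sub_eq_quadratic ha (b + a * r) (c + (b + a * r) * r)
  refine ⟨r, s, t, ?_, ?_, ?_⟩
  · linear_combination h₁
  · linear_combination h₂ - r * h₁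
  · linear_combination hr - r * h₂

/-- If a coordinate ratio is constant on a line defined over `K`, then it lies in `K`. -/
lemma mem_of_lineDefinedOver {K : IntermediateField ℚ Qbar}
    {W : Submodule Qbar (Fin 4 → Qbar)} (hK : LineDefinedOver K W) {i j : Fin 4} {θ : Qbar}
    (hθ : ∀ z ∈ W, z i = θ * z j) (hne : ∃ z ∈ W, z j ≠ 0) : θ ∈ K := by
  obtain ⟨v, w, hv, hw, rfl⟩ := hK
  have key : ∀ u ∈ span Qbar {v, w}, (∀ m, u m ∈ K) → u j ≠ 0 → θ ∈ K := by
    intro u hu huK huj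
    rw [eq_div_of_mul_eq huj (hθ u hu).symm]
    exact K.div_mem (huK i) (huK j)
  by_cases hvj : v j = 0
  · refine key w (subset_span (by simp)) hw fun hwj => ?_
    obtain ⟨z, hz, hzj⟩ := hne
    obtain ⟨s, t, rfl⟩ := mem_span_pair.1 hz
    exact hzj (by simp [hvj, hwj])
  · exact key v (subset_span (by simp)) hv hvj

lemma finrank_span_pair_eq_two {k V : Type*} [Field k] [AddCommGroup V] [Module k V] {v w : V}
    (h : ∀ s t : k, s • v + t • w = 0 → s = 0 ∧ t = 0) :
    Module.finrank k (span k {v, w}) = 2 := by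
  have := finrank_span_eq_card (LinearIndependent.pair_iff.2 h)
  rwa [Matrix.range_cons, Matrix.range_cons, Matrix.range_empty, Set.union_empty,
    Set.singleton_union, Fintype.card_fin] at this

lemma mem_of_root_of_lines {b₃ b₂ b₁ b₀ : ℤ} {K : IntermediateField ℚ Qbar}
    (hK : ∀ W ∈ surfaceLines (cubicFormA b₃ b₂ b₁ b₀), LineDefinedOver K W) {θ : Qbar}
    (hθ : cubicFormA b₃ b₂ b₁ b₀ θ 1 = 0) : θ ∈ K := by
  have hzero : ∀ s : Qbar, cubicFormA b₃ b₂ b₁ b₀ (s * θ) s = 0 := by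
    intro s
    simp only [cubicFormA] at hθ ⊢
    linear_combination s ^ 3 * hθ
  refine mem_of_lineDefinedOver (i := 0) (j := 1)
    (hK (span Qbar {![θ, 1, 0, 0], ![0, 0, θ, 1]}) ⟨?_, ?_⟩) ?_ ?_
  · refine finrank_span_pair_eq_two fun s t h => ⟨?_, ?_⟩
    · simpa using congrFun h 1
    · simpa using congrFun h 3
  · intro z hz
    obtain ⟨s, t, rfl⟩ := mem_span_pair.1 hz
    simp [hzero]
  · intro z hz
    obtain ⟨s, t, rfl⟩ := mem_span_pair.1 hz
    simp [mul_comm]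
  · exact ⟨_, subset_span (Set.mem_insert _ _), by simp⟩

lemma mem_of_cube_eq_one_of_lines {b₃ b₂ b₁ b₀ : ℤ} {K : IntermediateField ℚ Qbar}
    (hK : ∀ W ∈ surfaceLines (cubicFormA b₃ b₂ b₁ b₀), LineDefinedOver K W) {μ : Qbar}
    (hμ : μ ^ 3 = 1) : μ ∈ K := by
  refine mem_of_lineDefinedOver (i := 2) (j := 0)
    (hK (span Qbar {![1, 0, μ, 0], ![0, 1, 0, μ]}) ⟨?_, ?_⟩) ?_ ?_
  · refine finrank_span_pair_eq_two fun s t h => ⟨?_, ?_⟩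
    · simpa using congrFun h 0
    · simpa using congrFun h 1
  · intro z hz
    obtain ⟨s, t, rfl⟩ := mem_span_pair.1 hz
    simp [cubicFormA]
    linear_combination (-(b₃ * s ^ 3 + b₂ * s ^ 2 * t + b₁ * s * t ^ 2 + b₀ * t ^ 3)) * hμ
  · intro z hz
    obtain ⟨s, t, rfl⟩ := mem_span_pair.1 hz
    simp [mul_comm]
  · exact ⟨_, subset_span (Set.mem_insert _ _), by simp⟩

lemma lineDefinedOver_of_mem_surfaceLines {b₃ b₂ b₁ b₀ : ℤ} (hΔ : cubicDisc b₃ b₂ b₁ b₀ ≠ 0)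
    {μ : Qbar} (hμ : IsPrimitiveRoot μ 3) {K : IntermediateField ℚ Qbar} (hμK : μ ∈ K)
    (hroot : ∀ θ, cubicFormA b₃ b₂ b₁ b₀ θ 1 = 0 → θ ∈ K)
    {W : Submodule Qbar (Fin 4 → Qbar)} (hW : W ∈ surfaceLines (cubicFormA b₃ b₂ b₁ b₀)) :
    LineDefinedOver K W := by
  have hD : ((cubicDisc b₃ b₂ b₁ b₀ : ℤ) : Qbar) ≠ 0 := Int.cast_ne_zero.2 hΔ
  simp only [cubicDisc] at hD
  push_cast at hD
  by_cases h₃ : (b₃ : Qbar) = 0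
  · have h₂ : (b₂ : Qbar) ≠ 0 := by
      intro h₂
      simp [h₂, h₃] at hD
    obtain ⟨r, s, h₁, h₀⟩ := exists_mul_sub_eq_quadratic h₂ (b₁ : Qbar) (b₀ : Qbar)
    rw [h₀, h₁, h₃] at hD
    have hrs : s - r ≠ 0 := by
      intro h
      obtain rfl := sub_eq_zero.1 h
      exact hD (by ring)
    have hr : r ∈ K := hroot r (by simp only [cubicFormA, h₀, h₁, h₃]; ring)
    have hs : s ∈ K := hroot s (by simp only [cubicFormA, h₀, h₁, h₃]; ring)
    refine lineDefinedOver_of_factorization hμ hμK (e := -b₂ / (s - r)) (l₁ := 1) (l₂ := -r)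
      (m₁ := -1) (m₂ := s) (div_ne_zero (neg_ne_zero.2 h₂) hrs) K.one_mem (K.neg_mem hr)
      (K.neg_mem K.one_mem) hs (fun h => hrs (by linear_combination h)) ?_ hW
    intro x y
    simp only [cubicFormA, h₀, h₁, h₃]
    field_simp
    ring
  · obtain ⟨r, s, t, h₂, h₁, h₀⟩ :=
      exists_mul_sub_eq_cubic h₃ (b₂ : Qbar) (b₁ : Qbar) (b₀ : Qbar)
    rw [h₀, h₁, h₂] at hD
    have hrs : r - s ≠ 0 := by
      intro h
      obtain rfl := sub_eq_zero.1 h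
      exact hD (by ring)
    have hst : s - t ≠ 0 := by
      intro h
      obtain rfl := sub_eq_zero.1 h
      exact hD (by ring)
    have htr : t - r ≠ 0 := by
      intro h
      obtain rfl := sub_eq_zero.1 h
      exact hD (by ring)
    have hr : r ∈ K := hroot r (by simp only [cubicFormA, h₀, h₁, h₂]; ring)
    have hs : s ∈ K := hroot s (by simp only [cubicFormA, h₀, h₁, h₂]; ring)
    have ht : t ∈ K := hroot t (by simp only [cubicFormA, h₀, h₁, h₂]; ring)
    refine lineDefinedOver_of_factorization hμ hμK (e := -b₃ / ((r - s) * (s - t) * (t - r)))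
      (l₁ := s - t) (l₂ := -((s - t) * r)) (m₁ := t - r) (m₂ := -((t - r) * s))
      (div_ne_zero (neg_ne_zero.2 h₃) (mul_ne_zero (mul_ne_zero hrs hst) htr))
      (K.sub_mem hs ht) (K.neg_mem (K.mul_mem (K.sub_mem hs ht) hr))
      (K.sub_mem ht hr) (K.neg_mem (K.mul_mem (K.sub_mem ht hr) hs)) ?_ ?_ hW
    · intro h
      exact mul_ne_zero (mul_ne_zero hrs hst) htr (by linear_combination h)
    · intro x y
      simp only [cubicFormA, h₀, h₁, h₂]
      field_simp
      ring

end FieldOfDefinition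

/-- For a binary cubic form `F` with integer coefficients and non-zero discriminant, the
smallest field over which all the lines contained in the surface
`X_F : F(x₁,x₂) = F(x₃,x₄)` are defined is `𝔽(μ₃)`, where `𝔽` is the splitting field of
`F` and `μ₃` is a primitive third root of unity. -/
theorem smallest_field_of_definition_of_lines (b₃ b₂ b₁ b₀ : ℤ)
    (hΔ : cubicDisc b₃ b₂ b₁ b₀ ≠ 0) (μ : Qbar) (hμ : IsPrimitiveRoot μ 3) :
    (∀ W ∈ surfaceLines (cubicFormA b₃ b₂ b₁ b₀),
      LineDefinedOver (splittingFieldOfCubic b₃ b₂ b₁ b₀ ⊔ IntermediateField.adjoin ℚ {μ}) W) ∧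
    ∀ K : IntermediateField ℚ Qbar,
      (∀ W ∈ surfaceLines (cubicFormA b₃ b₂ b₁ b₀), LineDefinedOver K W) →
      splittingFieldOfCubic b₃ b₂ b₁ b₀ ⊔ IntermediateField.adjoin ℚ {μ} ≤ K := by
  refine ⟨fun W hW => ?_, fun K hK => ?_⟩
  · refine lineDefinedOver_of_mem_surfaceLines hΔ hμ ?_ (fun θ hθ => ?_) hW
    · exact (le_sup_right : _ ≤ splittingFieldOfCubic b₃ b₂ b₁ b₀ ⊔ _)
        (IntermediateField.mem_adjoin_simple_self ℚ μ)
    · exact (le_sup_left : splittingFieldOfCubic b₃ b₂ b₁ b₀ ≤ _)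
        (IntermediateField.subset_adjoin ℚ _ hθ)
  · refine sup_le (IntermediateField.adjoin_le_iff.2 fun θ hθ => mem_of_root_of_lines hK hθ) ?_
    exact IntermediateField.adjoin_simple_le_iff.2 (mem_of_cube_eq_one_of_lines hK hμ.pow_eq_one)
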